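/- arXiv:1405.7886 — 6 statements merged into one kernel-verified Lean document; each statement's English description precedes it below -/
import Mathlib

section
/- For all orthonormal vectors v₁, v₂, v₃, v₄ in ℝ⁸, |Φ₀(v₁,v₂,v₃,v₄)| ≤ 1; that is, the Cayley form Φ₀ has comass at most 1, so its restriction to any oriented 4-dimensional subspace is at most the volume form. -/
open scoped RealInnerProductSpace

noncomputable section

abbrev E8 := EuclideanSpace ℝ (Fin 8)

/-- The 4-form `dx_{ijkl}` on `ℝ⁸`. -/
def dx4 (i j k l : Fin 8) (v : Fin 4 → E8) : ℝ :=
  Matrix.det (Matrix.of fun r s : Fin 4 => v s (![i, j, k, l] r))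

/-- The Cayley 4-form `Φ₀` on `ℝ⁸`. -/
def Phi0 (v : Fin 4 → E8) : ℝ :=
  dx4 0 1 2 3 v + dx4 0 1 4 5 v - dx4 0 1 6 7 v + dx4 0 2 4 6 v + dx4 0 2 5 7 v
    + dx4 0 3 4 7 v - dx4 0 3 5 6 v - dx4 1 2 4 7 v + dx4 1 2 5 6 v + dx4 1 3 4 6 v
    + dx4 1 3 5 7 v - dx4 2 3 4 5 v + dx4 2 3 6 7 v + dx4 4 5 6 7 v

/-- The Cayley form applied to four vectors. -/
def Phi (a b c d : E8) : ℝ := Phi0 ![a, b, c, d]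

/-- The `i`-th standard basis vector of `ℝ⁸`. -/
def stdB (i : Fin 8) : E8 := EuclideanSpace.single i 1

/-- The triple cross product: the unique vector with `⟪x, u×v×w⟫ = Φ₀(x,u,v,w)`
for all `x`. -/
def crossTriple (u v w : E8) : E8 :=
  (EuclideanSpace.equiv (Fin 8) ℝ).symm fun i => Phi (stdB i) u v w

/-- A 4-dimensional subspace of `ℝ⁸` is Cayley if it has an orthonormal basis on which
`Φ₀` takes the value `1`. -/
def IsCayley (V : Submodule ℝ E8) : Prop :=
  Module.finrank ℝ V = 4 ∧
    ∃ v : Fin 4 → E8, (∀ i, v i ∈ V) ∧ Orthonormal ℝ v ∧ Phi0 v = 1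

/-- An octonion multiplication on `ℝ⁸` with unit `stdB 0`, compatible with `Phi0`. -/
def octMul (u w : E8) : E8 :=
  !₂[u 0 * w 0 - u 1 * w 1 - u 2 * w 2 - u 3 * w 3
      - u 4 * w 4 - u 5 * w 5 - u 6 * w 6 - u 7 * w 7,
    u 0 * w 1 + u 1 * w 0 + u 2 * w 3 - u 3 * w 2
      + u 4 * w 5 - u 5 * w 4 - u 6 * w 7 + u 7 * w 6,
    u 0 * w 2 - u 1 * w 3 + u 2 * w 0 + u 3 * w 1
      + u 4 * w 6 + u 5 * w 7 - u 6 * w 4 - u 7 * w 5,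
    u 0 * w 3 + u 1 * w 2 - u 2 * w 1 + u 3 * w 0
      + u 4 * w 7 - u 5 * w 6 + u 6 * w 5 - u 7 * w 4,
    u 0 * w 4 - u 1 * w 5 - u 2 * w 6 - u 3 * w 7
      + u 4 * w 0 + u 5 * w 1 + u 6 * w 2 + u 7 * w 3,
    u 0 * w 5 + u 1 * w 4 - u 2 * w 7 + u 3 * w 6
      - u 4 * w 1 + u 5 * w 0 - u 6 * w 3 + u 7 * w 2,
    u 0 * w 6 + u 1 * w 7 + u 2 * w 4 - u 3 * w 5
      - u 4 * w 2 + u 5 * w 3 + u 6 * w 0 - u 7 * w 1,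
    u 0 * w 7 - u 1 * w 6 + u 2 * w 5 + u 3 * w 4
      - u 4 * w 3 - u 5 * w 2 + u 6 * w 1 + u 7 * w 0]

/-- Octonion conjugation on `ℝ⁸`. -/
def octConj (v : E8) : E8 :=
  !₂[v 0, -v 1, -v 2, -v 3, -v 4, -v 5, -v 6, -v 7]

lemma inner_eq_sum_eight (x y : E8) :
    ⟪x, y⟫ = x 0 * y 0 + x 1 * y 1 + x 2 * y 2 + x 3 * y 3
      + x 4 * y 4 + x 5 * y 5 + x 6 * y 6 + x 7 * y 7 := by
  simp [PiLp.inner_apply, Fin.sum_univ_eight, mul_comm]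

/-- Degen's eight-square identity: the octonion norm is multiplicative. -/
lemma norm_octMul (u w : E8) : ‖octMul u w‖ = ‖u‖ * ‖w‖ := by
  rw [← sq_eq_sq₀ (norm_nonneg _) (by positivity), mul_pow]
  simp only [← real_inner_self_eq_norm_sq, inner_eq_sum_eight]
  simp [octMul]
  ring

lemma norm_octConj (v : E8) : ‖octConj v‖ = ‖v‖ := by
  rw [← sq_eq_sq₀ (norm_nonneg _) (norm_nonneg _)]
  simp only [← real_inner_self_eq_norm_sq, inner_eq_sum_eight]
  simp [octConj]

/-- The `4 × 4` determinant `dx4` expanded along `v 0`. -/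
lemma dx4_eq (i j k l : Fin 8) (v : Fin 4 → E8) :
    dx4 i j k l v =
      v 0 i * (v 1 j * (v 2 k * v 3 l - v 2 l * v 3 k) - v 1 k * (v 2 j * v 3 l - v 2 l * v 3 j)
        + v 1 l * (v 2 j * v 3 k - v 2 k * v 3 j))
      - v 0 j * (v 1 i * (v 2 k * v 3 l - v 2 l * v 3 k) - v 1 k * (v 2 i * v 3 l - v 2 l * v 3 i)
        + v 1 l * (v 2 i * v 3 k - v 2 k * v 3 i))
      + v 0 k * (v 1 i * (v 2 j * v 3 l - v 2 l * v 3 j) - v 1 j * (v 2 i * v 3 l - v 2 l * v 3 i)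
        + v 1 l * (v 2 i * v 3 j - v 2 j * v 3 i))
      - v 0 l * (v 1 i * (v 2 j * v 3 k - v 2 k * v 3 j) - v 1 j * (v 2 i * v 3 k - v 2 k * v 3 i)
        + v 1 k * (v 2 i * v 3 j - v 2 j * v 3 i)) := by
  simp [dx4, Matrix.det_succ_row_zero, Fin.sum_univ_succ, Fin.succAbove]
  ring

/-- The Cayley form in terms of octonion multiplication and inner products. -/
lemma inner_octMul_octMul_octConj (v : Fin 4 → E8) :
    ⟪v 0, octMul (v 1) (octMul (octConj (v 2)) (v 3))⟫ =
      Phi0 v + ⟪v 1, v 2⟫ * ⟪v 0, v 3⟫ + ⟪v 2, v 3⟫ * ⟪v 0, v 1⟫ - ⟪v 1, v 3⟫ * ⟪v 0, v 2⟫ := by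
  simp only [Phi0, dx4_eq, inner_eq_sum_eight]
  simp [octMul, octConj]
  ring

/-- The Cayley form `Φ₀` has comass at most `1`: on any orthonormal quadruple of
vectors of `ℝ⁸` its value has absolute value at most `1`. -/
theorem comass_le_one (v : Fin 4 → E8) (hv : Orthonormal ℝ v) :
    |Phi0 v| ≤ 1 := by
  have h : ⟪v 0, octMul (v 1) (octMul (octConj (v 2)) (v 3))⟫ = Phi0 v := by
    simp [inner_octMul_octMul_octConj, hv.inner_eq_zero]
  rw [← h]
  refine (abs_real_inner_le_norm _ _).trans_eq ?_
  simp [norm_octMul, norm_octConj, hv.1]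

end
end

section
/- For all u, v, w ∈ ℝ⁸, the squared norm ‖u×v×w‖² of the triple cross product equals the determinant of the 3×3 Gram matrix with entries ⟨u,u⟩, ⟨u,v⟩, ⟨u,w⟩, ⟨v,u⟩, ⟨v,v⟩, ⟨v,w⟩, ⟨w,u⟩, ⟨w,v⟩, ⟨w,w⟩; in particular, if u, v, w are orthonormal then u×v×w is a unit vector. (This is the identity |u×v×w| = |u∧v∧w|.) -/
open scoped RealInnerProductSpace

noncomputable section

/-- The `3 × 3` minor of `(u, v, w)` in the rows `i`, `j`, `k`. -/
def minor3 (u v w : E8) (i j k : Fin 8) : ℝ :=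
  u i * (v j * w k - v k * w j) - u j * (v i * w k - v k * w i)
    + u k * (v i * w j - v j * w i)

/-- Laplace expansion of `dx4` along its first argument. -/
theorem dx4_eq_minor3 (i j k l : Fin 8) (x u v w : E8) :
    dx4 i j k l ![x, u, v, w] =
      x i * minor3 u v w j k l - x j * minor3 u v w i k l
        + x k * minor3 u v w i j l - x l * minor3 u v w i j k := by
  simp [dx4, minor3, Matrix.det_succ_row_zero, Fin.sum_univ_succ, Fin.succAbove]
  ring

theorem crossTriple_apply (u v w : E8) (i : Fin 8) :
    crossTriple u v w i = Phi (stdB i) u v w := rfl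

theorem crossTriple_apply_zero (u v w : E8) :
    crossTriple u v w 0 =
      minor3 u v w 1 2 3 + minor3 u v w 1 4 5 - minor3 u v w 1 6 7 + minor3 u v w 2 4 6
        + minor3 u v w 2 5 7 + minor3 u v w 3 4 7 - minor3 u v w 3 5 6 := by
  simp [crossTriple_apply, Phi, Phi0, dx4_eq_minor3, stdB, sub_eq_add_neg]

theorem crossTriple_apply_one (u v w : E8) :
    crossTriple u v w 1 =
      -minor3 u v w 0 2 3 - minor3 u v w 0 4 5 + minor3 u v w 0 6 7 - minor3 u v w 2 4 7
        + minor3 u v w 2 5 6 + minor3 u v w 3 4 6 + minor3 u v w 3 5 7 := by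
  simp [crossTriple_apply, Phi, Phi0, dx4_eq_minor3, stdB, sub_eq_add_neg]

theorem crossTriple_apply_two (u v w : E8) :
    crossTriple u v w 2 =
      minor3 u v w 0 1 3 - minor3 u v w 0 4 6 - minor3 u v w 0 5 7 + minor3 u v w 1 4 7
        - minor3 u v w 1 5 6 - minor3 u v w 3 4 5 + minor3 u v w 3 6 7 := by
  simp [crossTriple_apply, Phi, Phi0, dx4_eq_minor3, stdB, sub_eq_add_neg]

theorem crossTriple_apply_three (u v w : E8) :
    crossTriple u v w 3 =
      -minor3 u v w 0 1 2 - minor3 u v w 0 4 7 + minor3 u v w 0 5 6 - minor3 u v w 1 4 6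
        - minor3 u v w 1 5 7 + minor3 u v w 2 4 5 - minor3 u v w 2 6 7 := by
  simp [crossTriple_apply, Phi, Phi0, dx4_eq_minor3, stdB, sub_eq_add_neg]

theorem crossTriple_apply_four (u v w : E8) :
    crossTriple u v w 4 =
      minor3 u v w 0 1 5 + minor3 u v w 0 2 6 + minor3 u v w 0 3 7 - minor3 u v w 1 2 7
        + minor3 u v w 1 3 6 - minor3 u v w 2 3 5 + minor3 u v w 5 6 7 := by
  simp [crossTriple_apply, Phi, Phi0, dx4_eq_minor3, stdB, sub_eq_add_neg]

theorem crossTriple_apply_five (u v w : E8) :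
    crossTriple u v w 5 =
      -minor3 u v w 0 1 4 + minor3 u v w 0 2 7 - minor3 u v w 0 3 6 + minor3 u v w 1 2 6
        + minor3 u v w 1 3 7 + minor3 u v w 2 3 4 - minor3 u v w 4 6 7 := by
  simp [crossTriple_apply, Phi, Phi0, dx4_eq_minor3, stdB, sub_eq_add_neg]

theorem crossTriple_apply_six (u v w : E8) :
    crossTriple u v w 6 =
      -minor3 u v w 0 1 7 - minor3 u v w 0 2 4 + minor3 u v w 0 3 5 - minor3 u v w 1 2 5
        - minor3 u v w 1 3 4 + minor3 u v w 2 3 7 + minor3 u v w 4 5 7 := by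
  simp [crossTriple_apply, Phi, Phi0, dx4_eq_minor3, stdB, sub_eq_add_neg]

theorem crossTriple_apply_seven (u v w : E8) :
    crossTriple u v w 7 =
      minor3 u v w 0 1 6 - minor3 u v w 0 2 5 - minor3 u v w 0 3 4 + minor3 u v w 1 2 4
        - minor3 u v w 1 3 5 - minor3 u v w 2 3 6 - minor3 u v w 4 5 6 := by
  simp [crossTriple_apply, Phi, Phi0, dx4_eq_minor3, stdB, sub_eq_add_neg]

set_option maxHeartbeats 4000000 in
set_option maxRecDepth 100000 in
/-- The squared norm of the triple cross product is the Gram determinant. -/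
theorem norm_sq_crossTriple_eq_det (u v w : E8) :
    ‖crossTriple u v w‖ ^ 2 =
        Matrix.det !![(⟪u, u⟫ : ℝ), ⟪u, v⟫, ⟪u, w⟫;
                      ⟪v, u⟫, ⟪v, v⟫, ⟪v, w⟫;
                      ⟪w, u⟫, ⟪w, v⟫, ⟪w, w⟫] := by
  simp only [Matrix.det_fin_three, Matrix.of_apply, Matrix.cons_val, EuclideanSpace.real_norm_sq_eq,
    PiLp.inner_apply, Fin.sum_univ_eight, RCLike.inner_apply, conj_trivial, crossTriple_apply_zero,
    crossTriple_apply_one, crossTriple_apply_two, crossTriple_apply_three,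
    crossTriple_apply_four, crossTriple_apply_five, crossTriple_apply_six,
    crossTriple_apply_seven, minor3]
  ring

/-- `|u×v×w| = |u∧v∧w|`: the squared norm of the triple cross product equals the Gram
determinant; in particular the triple cross product of orthonormal vectors is a unit
vector. -/
theorem norm_sq_crossTriple :
    (∀ u v w : E8,
      ‖crossTriple u v w‖ ^ 2 =
        Matrix.det !![(⟪u, u⟫ : ℝ), ⟪u, v⟫, ⟪u, w⟫;
                      ⟪v, u⟫, ⟪v, v⟫, ⟪v, w⟫;
                      ⟪w, u⟫, ⟪w, v⟫, ⟪w, w⟫]) ∧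
    ∀ u v w : E8, Orthonormal ℝ ![u, v, w] → ‖crossTriple u v w‖ = 1 := by
  refine ⟨norm_sq_crossTriple_eq_det, fun u v w h => ?_⟩
  have hi := orthonormal_iff_ite.mp h
  have huu : (⟪u, u⟫ : ℝ) = 1 := by simpa using hi 0 0
  have huv : (⟪u, v⟫ : ℝ) = 0 := by simpa using hi 0 1
  have huw : (⟪u, w⟫ : ℝ) = 0 := by simpa using hi 0 2
  have hvu : (⟪v, u⟫ : ℝ) = 0 := by simpa using hi 1 0
  have hvv : (⟪v, v⟫ : ℝ) = 1 := by simpa using hi 1 1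
  have hvw : (⟪v, w⟫ : ℝ) = 0 := by simpa using hi 1 2
  have hwu : (⟪w, u⟫ : ℝ) = 0 := by simpa using hi 2 0
  have hwv : (⟪w, v⟫ : ℝ) = 0 := by simpa using hi 2 1
  have hww : (⟪w, w⟫ : ℝ) = 1 := by simpa using hi 2 2
  rw [← sq_eq_sq₀ (norm_nonneg _) zero_le_one, norm_sq_crossTriple_eq_det,
    huu, huv, huw, hvu, hvv, hvw, hwu, hwv, hww]
  simp [Matrix.det_fin_three]

end
end

section
/- Let (v₁,v₂,v₃,v₄) be orthonormal vectors in ℝ⁸. Then Φ₀(v₁,v₂,v₃,v₄) = 1 if and only if v₂×v₃×v₄ = v₁. Consequently, if X ⊆ ℝ⁸ is a Cayley subspace with orthonormal basis (v₁,v₂,v₃,v₄) satisfying Φ₀(v₁,v₂,v₃,v₄) = 1, then Φ₀(x,v₂,v₃,v₄) = ⟨x,v₁⟩ for every x ∈ ℝ⁸. -/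
open scoped RealInnerProductSpace

noncomputable section

theorem dx4_apply (i j k l : Fin 8) (a b c d : E8) :
    dx4 i j k l ![a, b, c, d] =
      (a i * b j - a j * b i) * (c k * d l - c l * d k)
      - (a i * b k - a k * b i) * (c j * d l - c l * d j)
      + (a i * b l - a l * b i) * (c j * d k - c k * d j)
      + (a j * b k - a k * b j) * (c i * d l - c l * d i)
      - (a j * b l - a l * b j) * (c i * d k - c k * d i)
      + (a k * b l - a l * b k) * (c i * d j - c j * d i) := by
  simp [dx4, Matrix.det_succ_row_zero, Fin.sum_univ_succ, Fin.succAbove]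
  ring

theorem Phi_eq_inner_crossTriple (x u v w : E8) :
    Phi x u v w = ⟪x, crossTriple u v w⟫ := by
  simp only [PiLp.inner_apply, Fin.sum_univ_eight]
  simp [crossTriple, Phi, Phi0, dx4_apply, stdB]
  ring

set_option maxHeartbeats 4000000 in
/-- The norm of the triple cross product is given by the Gram determinant. -/
theorem inner_crossTriple_self (u v w : E8) :
    ⟪crossTriple u v w, crossTriple u v w⟫ =
      ⟪u, u⟫ * ⟪v, v⟫ * ⟪w, w⟫ + 2 * ⟪u, v⟫ * ⟪v, w⟫ * ⟪u, w⟫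
      - ⟪u, u⟫ * ⟪v, w⟫ ^ 2 - ⟪v, v⟫ * ⟪u, w⟫ ^ 2 - ⟪w, w⟫ * ⟪u, v⟫ ^ 2 := by
  simp only [PiLp.inner_apply, Fin.sum_univ_eight]
  simp [crossTriple, Phi, Phi0, dx4_apply, stdB]
  ring

/-- For orthonormal `(v₁,v₂,v₃,v₄)` in `ℝ⁸`: `Φ₀(v₁,v₂,v₃,v₄) = 1` iff
`v₂×v₃×v₄ = v₁`; consequently, for a Cayley subspace with such an orthonormal basis,
`Φ₀(x,v₂,v₃,v₄) = ⟪x,v₁⟫` for every `x`. -/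
theorem cayley_calibrated_iff_cross (v₁ v₂ v₃ v₄ : E8)
    (hv : Orthonormal ℝ ![v₁, v₂, v₃, v₄]) :
    (Phi v₁ v₂ v₃ v₄ = 1 ↔ crossTriple v₂ v₃ v₄ = v₁) ∧
    (Phi v₁ v₂ v₃ v₄ = 1 → ∀ x : E8, Phi x v₂ v₃ v₄ = ⟪x, v₁⟫) := by
  have hself (i : Fin 4) := real_inner_self_eq_norm_sq (![v₁, v₂, v₃, v₄] i)
  simp only [hv.1] at hself
  have h₁ : ⟪v₁, v₁⟫ = 1 := by simpa using hself 0
  have h₂ : ⟪v₂, v₂⟫ = 1 := by simpa using hself 1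
  have h₃ : ⟪v₃, v₃⟫ = 1 := by simpa using hself 2
  have h₄ : ⟪v₄, v₄⟫ = 1 := by simpa using hself 3
  have h₂₃ : ⟪v₂, v₃⟫ = 0 := hv.2 (show (1 : Fin 4) ≠ 2 by decide)
  have h₂₄ : ⟪v₂, v₄⟫ = 0 := hv.2 (show (1 : Fin 4) ≠ 3 by decide)
  have h₃₄ : ⟪v₃, v₄⟫ = 0 := hv.2 (show (2 : Fin 4) ≠ 3 by decide)
  have hcross : ⟪crossTriple v₂ v₃ v₄, crossTriple v₂ v₃ v₄⟫ = 1 := by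
    rw [inner_crossTriple_self, h₂, h₃, h₄, h₂₃, h₂₄, h₃₄]
    norm_num
  have hnorm {x : E8} (hx : ⟪x, x⟫ = 1) : ‖x‖ = 1 := by
    rw [norm_eq_sqrt_real_inner, hx, Real.sqrt_one]
  have key : Phi v₁ v₂ v₃ v₄ = 1 ↔ crossTriple v₂ v₃ v₄ = v₁ := by
    rw [Phi_eq_inner_crossTriple, inner_eq_one_iff_of_norm_eq_one (hnorm h₁) (hnorm hcross),
      eq_comm]
  refine ⟨key, fun h x => ?_⟩
  rw [Phi_eq_inner_crossTriple, key.1 h]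

end
end

section
/- Every linear automorphism g of ℝ⁸ satisfying Φ₀(g v₁, g v₂, g v₃, g v₄) = Φ₀(v₁,v₂,v₃,v₄) for all v₁, v₂, v₃, v₄ ∈ ℝ⁸ is a special orthogonal transformation: ⟨g x, g y⟩ = ⟨x, y⟩ for all x, y ∈ ℝ⁸ and det g = 1. (The stabiliser of Φ₀ in GL(8,ℝ) is contained in SO(8).) -/
open scoped RealInnerProductSpace

noncomputable section

/-- The Cayley form as an alternating map. -/
def cayleyForm : E8 [⋀^Fin 4]→ₗ[ℝ] ℝ :=
  let d (i j k l : Fin 8) : E8 [⋀^Fin 4]→ₗ[ℝ] ℝ :=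
    (Matrix.detRowAlternating (n := Fin 4) (R := ℝ)).compLinearMap
      (LinearMap.pi fun r => (EuclideanSpace.proj (𝕜 := ℝ) (![i, j, k, l] r)).toLinearMap)
  d 0 1 2 3 + d 0 1 4 5 - d 0 1 6 7 + d 0 2 4 6 + d 0 2 5 7 + d 0 3 4 7 - d 0 3 5 6
    - d 1 2 4 7 + d 1 2 5 6 + d 1 3 4 6 + d 1 3 5 7 - d 2 3 4 5 + d 2 3 6 7 + d 4 5 6 7

theorem cayleyForm_apply (v : Fin 4 → E8) : cayleyForm v = Phi0 v := by
  have key (i j k l : Fin 8) : (Matrix.detRowAlternating (n := Fin 4) (R := ℝ)).compLinearMap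
      (LinearMap.pi fun r => (EuclideanSpace.proj (𝕜 := ℝ) (![i, j, k, l] r)).toLinearMap) v
      = dx4 i j k l v := by
    rw [dx4, ← Matrix.det_transpose]
    rfl
  simp only [cayleyForm, AlternatingMap.add_apply, AlternatingMap.sub_apply, key, Phi0]

/-- The `2 × 2` minor of the coordinates `i`, `j` of two vectors. -/
def minor2 (x y : E8) (i j : Fin 8) : ℝ := x i * y j - x j * y i

theorem dx4_eq_minor2 (i j k l : Fin 8) (a b x y : E8) :
    dx4 i j k l ![a, b, x, y] =
      minor2 a b i j * minor2 x y k l - minor2 a b i k * minor2 x y j l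
      + minor2 a b i l * minor2 x y j k + minor2 a b j k * minor2 x y i l
      - minor2 a b j l * minor2 x y i k + minor2 a b k l * minor2 x y i j := by
  simp [dx4, Matrix.det_succ_row_zero, Fin.sum_univ_succ, minor2, Fin.succAbove]
  ring

theorem minor2_stdB (k l i j : Fin 8) :
    minor2 (stdB k) (stdB l) i j =
      (if i = k then 1 else 0) * (if j = l then 1 else 0)
        - (if j = k then 1 else 0) * (if i = l then 1 else 0) := by
  simp [minor2, stdB]

set_option maxHeartbeats 4000000 in
theorem sum_sq_cayleyForm_stdB (x y : E8) :
    ∑ k, ∑ l, cayleyForm ![stdB k, stdB l, x, y] ^ 2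
      = 6 * (⟪x, x⟫ * ⟪y, y⟫ - ⟪x, y⟫ ^ 2 : ℝ) := by
  simp only [cayleyForm_apply, Phi0, dx4_eq_minor2, minor2_stdB, Fin.sum_univ_eight]
  simp +decide only [if_true, if_false, mul_zero, zero_mul, mul_one, sub_zero,
    zero_sub, zero_add, add_zero, one_mul, sub_self]
  simp only [minor2, PiLp.inner_apply, Fin.sum_univ_eight, RCLike.inner_apply, conj_trivial]
  ring

theorem sum_fin_four {α M : Type*} [Fintype α] [AddCommMonoid M] (f : (Fin 4 → α) → M) :
    ∑ p, f p = ∑ i, ∑ j, ∑ k, ∑ l, f ![i, j, k, l] := by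
  let e : (Fin 4 → α) ≃ α × α × α × α :=
    { toFun p := (p 0, p 1, p 2, p 3)
      invFun q := ![q.1, q.2.1, q.2.2.1, q.2.2.2]
      left_inv p := by ext i; fin_cases i <;> rfl
      right_inv q := rfl }
  rw [← e.symm.sum_comp f]
  simp only [Fintype.sum_prod_type]
  rfl

theorem OrthonormalBasis.sum_sq_linearMap_eq {E ι κ : Type*} [NormedAddCommGroup E]
    [InnerProductSpace ℝ E] [Fintype ι] [Fintype κ] (b : OrthonormalBasis ι ℝ E)
    (c : OrthonormalBasis κ ℝ E) (f : E →ₗ[ℝ] ℝ) :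
    ∑ i, f (b i) ^ 2 = ∑ j, f (c j) ^ 2 := by
  have key (z : E) : f z = ⟪∑ j, f (c j) • c j, z⟫ := by
    conv_lhs => rw [← c.sum_repr' z]
    simp [sum_inner, inner_smul_left, mul_comm]
  generalize ∑ j, f (c j) • c j = v at key
  simp only [key]
  simpa using (b.sum_sq_norm_inner_left v).trans (c.sum_sq_norm_inner_left v).symm

/-- A symmetric weight on quadruples whose sum over two of the indices is `6` off the
diagonal and `0` on it. -/
structure IsPairBalanced (w : (Fin 4 → Fin 8) → ℝ) : Prop where
  nonneg : ∀ p, 0 ≤ w p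
  symm : ∀ (p : Fin 4 → Fin 8) (σ : Equiv.Perm (Fin 4)), w (p ∘ σ) = w p
  sum_pair : ∀ k l, ∑ i, ∑ j, w ![i, j, k, l] = if k = l then 0 else 6

namespace IsPairBalanced

variable {w : (Fin 4 → Fin 8) → ℝ}

theorem sum_mul (hw : IsPairBalanced w) {s t : Fin 4} (hst : s ≠ t) (h : Fin 8 → Fin 8 → ℝ) :
    ∑ p, w p * h (p s) (p t) = 6 * (∑ i, ∑ j, h i j - ∑ i, h i i) := by
  obtain ⟨σ, rfl, rfl⟩ : ∃ σ : Equiv.Perm (Fin 4), σ 2 = s ∧ σ 3 = t := by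
    revert s t; decide
  rw [← (σ.symm.arrowCongr (Equiv.refl (Fin 8))).symm.sum_comp]
  have h1 (p : Fin 4 → Fin 8) :
      (σ.symm.arrowCongr (Equiv.refl (Fin 8))).symm p = p ∘ σ.symm := rfl
  simp only [h1, hw.symm, Function.comp_apply, Equiv.symm_apply_apply]
  rw [sum_fin_four]
  have h2 : ∑ i, ∑ j, ∑ k, ∑ l, w ![i, j, k, l] * h k l
      = ∑ k, ∑ l, (∑ i, ∑ j, w ![i, j, k, l]) * h k l := by
    simp only [Finset.sum_mul]
    rw [← Fintype.sum_prod_type', Finset.sum_congr rfl fun _ _ => (Fintype.sum_prod_type' _).symm, Finset.sum_comm, Fintype.sum_prod_type]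
    simp only [Fintype.sum_prod_type]
  simp only [Matrix.cons_val]
  rw [h2]
  simp only [hw.sum_pair, Finset.mul_sum, mul_sub, ite_mul, zero_mul, ← Finset.sum_sub_distrib]
  refine Finset.sum_congr rfl fun i _ => ?_
  rw [eq_sub_iff_add_eq, ← Finset.sum_erase_add _ _ (Finset.mem_univ i),
    ← Finset.sum_erase_add _ _ (Finset.mem_univ i), if_pos rfl, add_zero]
  refine congrArg (· + _) (Finset.sum_congr rfl fun j hj => ?_)
  rw [if_neg (Finset.ne_of_mem_erase hj).symm]

theorem sum_mul_single (hw : IsPairBalanced w) (s : Fin 4) (h : Fin 8 → ℝ) :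
    ∑ p, w p * h (p s) = 42 * ∑ i, h i := by
  obtain ⟨t, ht⟩ : ∃ t, s ≠ t := (exists_ne s).imp fun _ => Ne.symm
  rw [hw.sum_mul ht fun i _ => h i]
  simp only [Finset.sum_const, Finset.card_univ, Fintype.card_fin, nsmul_eq_mul,
    ← Finset.mul_sum]
  push_cast
  ring

theorem sum_eq (hw : IsPairBalanced w) : ∑ p, w p = 336 := by
  have := hw.sum_mul_single 0 fun _ => 1
  norm_num at this
  exact this

theorem sum_mul_sum (hw : IsPairBalanced w) (X : Fin 8 → ℝ) :
    ∑ p, w p * ∑ s, X (p s) = 168 * ∑ i, X i := by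
  simp only [Finset.mul_sum _ _ (w _)]
  rw [Finset.sum_comm]
  simp only [hw.sum_mul_single _ X, Finset.sum_const, Finset.card_univ, Fintype.card_fin]
  norm_num
  ring

theorem sum_mul_sum_sq (hw : IsPairBalanced w) (X : Fin 8 → ℝ) :
    ∑ p, w p * (∑ s, X (p s)) ^ 2 = 96 * ∑ i, X i ^ 2 + 72 * (∑ i, X i) ^ 2 := by
  have h1 (s t : Fin 4) : ∑ p, w p * (X (p s) * X (p t)) =
      if s = t then 42 * ∑ i, X i ^ 2 else 6 * ((∑ i, X i) ^ 2 - ∑ i, X i ^ 2) := by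
    split_ifs with hst
    · subst hst
      simpa only [sq] using hw.sum_mul_single s fun i => X i * X i
    · rw [hw.sum_mul hst fun i j => X i * X j, sq, Finset.sum_mul_sum]
      simp only [sq]
  calc ∑ p, w p * (∑ s, X (p s)) ^ 2
      = ∑ s, ∑ t, ∑ p, w p * (X (p s) * X (p t)) := by
        simp_rw [sq, Finset.sum_mul_sum, Finset.mul_sum]
        rw [Finset.sum_comm]
        exact Finset.sum_congr rfl fun _ _ => Finset.sum_comm
    _ = _ := by
        simp only [h1, Fin.sum_univ_four]
        simp +decide only [if_true, if_false]
        ring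

/-- Two pair-balanced weights that differ by multiplicative factors `(d i * d j * d k * d l) ^ 2`
can only be related by the trivial factors `d = 1`. -/
theorem eq_one_of_forall_eq_mul {w' : (Fin 4 → Fin 8) → ℝ} (hw : IsPairBalanced w)
    (hw' : IsPairBalanced w') (d : Fin 8 → ℝ) (hd : ∀ i, 0 < d i)
    (h : ∀ p, w' p = (∏ s, d (p s)) ^ 2 * w p) (i : Fin 8) : d i = 1 := by
  let X (i : Fin 8) : ℝ := Real.log (d i)
  let t (p : Fin 4 → Fin 8) : ℝ := (∏ s, d (p s)) ^ 2
  have ht (p) : 0 < t p := pow_pos (Finset.prod_pos fun s _ => hd _) 2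
  have hlog (p) : Real.log (t p) = 2 * ∑ s, X (p s) := by
    rw [Real.log_pow, Real.log_prod fun s _ => (hd _).ne']
    rfl
  have hX_nonneg : 0 ≤ ∑ i, X i := by
    have h1 : 0 ≤ ∑ p, (w p - w' p + 2 * (w' p * ∑ s, X (p s))) := by
      refine Finset.sum_nonneg fun p _ => ?_
      have h2 := Real.log_le_sub_one_of_pos (inv_pos.2 (ht p))
      rw [Real.log_inv, hlog] at h2
      have h3 : w p = w' p * (t p)⁻¹ := by
        rw [h p]
        exact (mul_inv_cancel_left₀ (ht p).ne' _).symm.trans (by ring)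
      rw [h3]
      nlinarith [hw'.nonneg p]
    rw [Finset.sum_add_distrib, Finset.sum_sub_distrib, hw.sum_eq, hw'.sum_eq, ← Finset.mul_sum,
      hw'.sum_mul_sum] at h1
    linarith
  have hterm (p) : 0 ≤ w' p - w p - 2 * (w p * ∑ s, X (p s)) := by
    have h2 := Real.log_le_sub_one_of_pos (ht p)
    rw [hlog] at h2
    have h3 : w' p = t p * w p := h p
    rw [h3]
    nlinarith [hw.nonneg p]
  have hsum : ∑ p, (w' p - w p - 2 * (w p * ∑ s, X (p s))) = -336 * ∑ i, X i := by
    rw [Finset.sum_sub_distrib, Finset.sum_sub_distrib, hw.sum_eq, hw'.sum_eq, ← Finset.mul_sum,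
      hw.sum_mul_sum]
    ring
  have hzero : ∑ p, (w' p - w p - 2 * (w p * ∑ s, X (p s))) = 0 :=
    le_antisymm (by rw [hsum]; linarith) (Finset.sum_nonneg fun p _ => hterm p)
  have hsq (p) : w p * (∑ s, X (p s)) ^ 2 = 0 := by
    have h1 := (Finset.sum_eq_zero_iff_of_nonneg fun p _ => hterm p).1 hzero p (Finset.mem_univ p)
    rcases eq_or_ne (t p) 1 with h2 | h2
    · have h3 := hlog p
      rw [h2, Real.log_one] at h3
      rw [show ∑ s, X (p s) = 0 by linarith]
      ring
    · have h3 := Real.log_lt_sub_one_of_pos (ht p) h2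
      rw [hlog] at h3
      have h4 : w p * (t p - 1 - 2 * ∑ s, X (p s)) = 0 := by
        rw [← h1, h p]
        change _ = t p * w p - _ - _
        ring
      rw [(mul_eq_zero.1 h4).resolve_right (by linarith), zero_mul]
  have hX : ∑ i, X i ^ 2 = 0 := by
    have h1 := hw.sum_mul_sum_sq X
    simp only [hsq, Finset.sum_const_zero] at h1
    have h2 : 0 ≤ ∑ i, X i ^ 2 := Finset.sum_nonneg fun i _ => sq_nonneg _
    nlinarith [sq_nonneg (∑ i, X i)]
  have hi := (Finset.sum_eq_zero_iff_of_nonneg fun i _ => sq_nonneg (X i)).1 hX i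
    (Finset.mem_univ i)
  exact Real.eq_one_of_pos_of_log_eq_zero (hd i) (pow_eq_zero_iff two_ne_zero |>.1 hi)

end IsPairBalanced

theorem isPairBalanced_cayleyForm (b : OrthonormalBasis (Fin 8) ℝ E8) :
    IsPairBalanced fun p => cayleyForm (b ∘ p) ^ 2 where
  nonneg _ := sq_nonneg _
  symm p σ := by
    rw [← Function.comp_assoc, AlternatingMap.map_perm]
    rcases Int.units_eq_one_or σ.sign with h | h <;> simp [h]
  sum_pair k l := by
    have hcomp (i j : Fin 8) : b ∘ ![i, j, k, l] = ![b i, b j, b k, b l] := by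
      ext s : 1
      fin_cases s <;> rfl
    have h0 (y z t : E8) : ∑ i, cayleyForm ![b i, y, z, t] ^ 2
        = ∑ i, cayleyForm ![stdB i, y, z, t] ^ 2 := by
      have h := b.sum_sq_linearMap_eq (EuclideanSpace.basisFun (Fin 8) ℝ)
        (cayleyForm.toMultilinearMap.toLinearMap ![0, y, z, t] 0)
      have hu (x : E8) : Function.update ![0, y, z, t] 0 x = ![x, y, z, t] := by
        ext s : 1
        fin_cases s <;> rfl
      simp only [MultilinearMap.toLinearMap_apply, AlternatingMap.coe_multilinearMap, hu,
        EuclideanSpace.basisFun_apply] at h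
      simp only [stdB]
      convert h using 4
    have h1 (x z t : E8) : ∑ i, cayleyForm ![x, b i, z, t] ^ 2
        = ∑ i, cayleyForm ![x, stdB i, z, t] ^ 2 := by
      have h := b.sum_sq_linearMap_eq (EuclideanSpace.basisFun (Fin 8) ℝ)
        (cayleyForm.toMultilinearMap.toLinearMap ![x, 0, z, t] 1)
      have hu (y : E8) : Function.update ![x, 0, z, t] 1 y = ![x, y, z, t] := by
        ext s : 1
        fin_cases s <;> rfl
      simp only [MultilinearMap.toLinearMap_apply, AlternatingMap.coe_multilinearMap, hu,
        EuclideanSpace.basisFun_apply] at h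
      simp only [stdB]
      convert h using 4
    simp only [hcomp, h1]
    rw [Finset.sum_comm]
    simp only [h0]
    rw [Finset.sum_comm, sum_sq_cayleyForm_stdB]
    simp only [b.inner_eq_ite]
    split_ifs <;> norm_num

/-- An invertible map sends a suitable orthonormal basis to positive multiples of another
orthonormal basis (singular value decomposition). -/
theorem exists_orthonormalBasis_apply_eq_smul (g : E8 ≃ₗ[ℝ] E8) :
    ∃ (a b : OrthonormalBasis (Fin 8) ℝ E8) (d : Fin 8 → ℝ),
      (∀ i, 0 < d i) ∧ ∀ i, g (a i) = d i • b i := by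
  let g' : E8 →ₗ[ℝ] E8 := g
  have hS : (g'.adjoint ∘ₗ g').IsSymmetric := g'.isSymmetric_adjoint_mul_self
  let a := hS.eigenvectorBasis (finrank_euclideanSpace_fin (𝕜 := ℝ) (n := 8))
  have hne (i) : g (a i) ≠ 0 := by
    rw [Ne, LinearEquiv.map_eq_zero_iff]
    exact a.orthonormal.ne_zero i
  have horth (i j) (hij : i ≠ j) : (⟪g (a i), g (a j)⟫ : ℝ) = 0 := by
    have h1 : (⟪g (a i), g (a j)⟫ : ℝ) = ⟪a i, (g'.adjoint ∘ₗ g') (a j)⟫ :=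
      (g'.adjoint_inner_right (a i) (g (a j))).symm
    rw [h1, hS.apply_eigenvectorBasis, inner_smul_right]
    exact mul_eq_zero_of_right _ (a.orthonormal.2 hij)
  have hb : Orthonormal ℝ fun i => (‖g (a i)‖⁻¹ : ℝ) • g (a i) := by
    refine ⟨fun i => norm_smul_inv_norm (hne i), fun i j hij => ?_⟩
    simp only [inner_smul_left, inner_smul_right, horth i j hij, mul_zero]
  let B := basisOfOrthonormalOfCardEqFinrank hb (by simp)
  have hB : ⇑B = fun i => (‖g (a i)‖⁻¹ : ℝ) • g (a i) :=
    coe_basisOfOrthonormalOfCardEqFinrank hb (by simp)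
  refine ⟨a, B.toOrthonormalBasis (hB ▸ hb), fun i => ‖g (a i)‖, fun i => norm_pos_iff.2 (hne i),
    fun i => ?_⟩
  rw [Module.Basis.coe_toOrthonormalBasis, hB]
  exact (smul_inv_smul₀ (norm_ne_zero_iff.2 (hne i)) _).symm

theorem inner_map_map_of_cayleyForm_comp (g : E8 ≃ₗ[ℝ] E8)
    (h : ∀ v, cayleyForm (g ∘ v) = cayleyForm v) (x y : E8) : (⟪g x, g y⟫ : ℝ) = ⟪x, y⟫ := by
  obtain ⟨a, b, d, hd, hg⟩ := exists_orthonormalBasis_apply_eq_smul g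
  have hw (p : Fin 4 → Fin 8) :
      cayleyForm (a ∘ p) ^ 2 = (∏ s, d (p s)) ^ 2 * cayleyForm (b ∘ p) ^ 2 := by
    have hp : g ∘ a ∘ p = fun s => d (p s) • (b ∘ p) s := funext fun s => hg (p s)
    rw [← h, hp, AlternatingMap.map_smul_univ, smul_eq_mul, mul_pow]
  have hd1 := (isPairBalanced_cayleyForm b).eq_one_of_forall_eq_mul
    (isPairBalanced_cayleyForm a) d hd hw
  have hgab : g.toLinearMap = (a.equiv b (Equiv.refl _)).toLinearEquiv.toLinearMap :=
    a.toBasis.ext fun i => by simp [hg, hd1]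
  have hg' (z : E8) : g z = a.equiv b (Equiv.refl _) z := LinearMap.congr_fun hgab z
  rw [hg', hg', LinearIsometryEquiv.inner_map_map]

open scoped Matrix in
/-- Jacobi's identity for complementary minors of an orthogonal matrix. -/
theorem Matrix.det_toBlocks₁₁_eq_of_mul_transpose_eq_one {m n R : Type*} [Fintype m] [Fintype n]
    [DecidableEq m] [DecidableEq n] [CommRing R] (M : Matrix (m ⊕ n) (m ⊕ n) R)
    (hM : M * Mᵀ = 1) : M.toBlocks₁₁.det = M.det * M.toBlocks₂₂.det := by
  obtain ⟨A, B, C, D, rfl⟩ : ∃ A B C D, M = Matrix.fromBlocks A B C D :=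
    ⟨_, _, _, _, M.fromBlocks_toBlocks.symm⟩
  rw [Matrix.fromBlocks_transpose, Matrix.fromBlocks_multiply, ← Matrix.fromBlocks_one,
    Matrix.fromBlocks_inj] at hM
  have h : Matrix.fromBlocks A B C D * Matrix.fromBlocks 1 Cᵀ 0 Dᵀ
      = Matrix.fromBlocks A 0 C 1 := by
    rw [Matrix.fromBlocks_multiply, hM.2.1, hM.2.2.2]
    simp
  simpa using (congrArg Matrix.det h).symm

open scoped Matrix in
theorem Matrix.det_submatrix_eq_mul_det_submatrix (G : Matrix (Fin 8) (Fin 8) ℝ)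
    (hG : G * Gᵀ = 1) (σ : Equiv.Perm (Fin 8)) (hσ : σ.sign = 1) :
    (G.submatrix (σ ∘ (Fin.castAdd 4 : Fin 4 → Fin 8)) (Fin.castAdd 4)).det
      = G.det * (G.submatrix (σ ∘ (Fin.natAdd 4 : Fin 4 → Fin 8))
        (Fin.natAdd 4 : Fin 4 → Fin 8)).det := by
  let e : Fin 4 ⊕ Fin 4 ≃ Fin 8 := finSumFinEquiv
  have h := Matrix.det_toBlocks₁₁_eq_of_mul_transpose_eq_one (G.submatrix (e.trans σ) e) (by
    rw [Matrix.transpose_submatrix, Matrix.submatrix_mul_equiv, hG, Matrix.submatrix_one_equiv])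
  have hdet : (G.submatrix (e.trans σ) e).det = G.det := by
    rw [← Matrix.det_submatrix_equiv_self e G]
    have := Matrix.det_permute σ G
    rw [hσ] at this
    rw [← Matrix.det_submatrix_equiv_self e (G.submatrix σ id)] at this
    simpa using this
  rw [hdet] at h
  exact h

open scoped Matrix in
theorem det_eq_one_of_cayleyForm_comp (g : E8 ≃ₗ[ℝ] E8)
    (h : ∀ v, cayleyForm (g ∘ v) = cayleyForm v)
    (hg : ∀ x y : E8, (⟪g x, g y⟫ : ℝ) = ⟪x, y⟫) : LinearMap.det (g : E8 →ₗ[ℝ] E8) = 1 := by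
  let G : Matrix (Fin 8) (Fin 8) ℝ := Matrix.of fun i j => g (stdB j) i
  have hdet : LinearMap.det (g : E8 →ₗ[ℝ] E8) = G.det := by
    rw [← LinearMap.det_toMatrix (EuclideanSpace.basisFun (Fin 8) ℝ).toBasis]
    congr 1
  have hG : G * Gᵀ = 1 := by
    rw [mul_eq_one_comm]
    ext i j
    have hij := hg (stdB j) (stdB i)
    have hst : (⟪stdB j, stdB i⟫ : ℝ) = (1 : Matrix (Fin 8) (Fin 8) ℝ) i j := by
      simp [stdB, EuclideanSpace.inner_single_left, Matrix.one_apply, eq_comm]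
    rw [hst, PiLp.inner_apply] at hij
    simpa [Matrix.mul_apply, G] using hij
  have hminor (f : Fin 8 → Fin 8) (hf : Function.Bijective f)
      (hs : ∏ j, ∏ i ∈ Finset.Iio j, (if f i < f j then 1 else -1 : ℤˣ) = 1) :
      dx4 (f 0) (f 1) (f 2) (f 3) (g ∘ ![stdB 0, stdB 1, stdB 2, stdB 3])
        = G.det * dx4 (f 4) (f 5) (f 6) (f 7) (g ∘ ![stdB 4, stdB 5, stdB 6, stdB 7]) := by
    have h1 := Matrix.det_submatrix_eq_mul_det_submatrix G hG (Equiv.ofBijective f hf)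
      ((Equiv.Perm.sign_eq_prod_prod_Iio _).trans hs)
    convert h1 using 2
    · unfold dx4
      congr 1
      ext r s
      fin_cases r <;> fin_cases s <;> rfl
    · unfold dx4
      congr 1
      ext r s
      fin_cases r <;> fin_cases s <;> rfl
  have h0 : cayleyForm ![stdB 0, stdB 1, stdB 2, stdB 3] = 1 := by
    simp [cayleyForm_apply, Phi0, dx4_eq_minor2, minor2_stdB]
  have h4 : cayleyForm ![stdB 4, stdB 5, stdB 6, stdB 7] = 1 := by
    simp [cayleyForm_apply, Phi0, dx4_eq_minor2, minor2_stdB]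
  rw [← h, cayleyForm_apply, Phi0] at h0 h4
  rw [hdet]
  have m1 := hminor ![0, 1, 2, 3, 4, 5, 6, 7] (by decide) (by decide)
  have m2 := hminor ![0, 1, 4, 5, 2, 3, 6, 7] (by decide) (by decide)
  have m3 := hminor ![0, 1, 6, 7, 2, 3, 4, 5] (by decide) (by decide)
  have m4 := hminor ![0, 2, 4, 6, 1, 3, 5, 7] (by decide) (by decide)
  have m5 := hminor ![0, 2, 5, 7, 1, 3, 4, 6] (by decide) (by decide)
  have m6 := hminor ![0, 3, 4, 7, 1, 2, 5, 6] (by decide) (by decide)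
  have m7 := hminor ![0, 3, 5, 6, 1, 2, 4, 7] (by decide) (by decide)
  have m8 := hminor ![1, 2, 4, 7, 0, 3, 5, 6] (by decide) (by decide)
  have m9 := hminor ![1, 2, 5, 6, 0, 3, 4, 7] (by decide) (by decide)
  have m10 := hminor ![1, 3, 4, 6, 0, 2, 5, 7] (by decide) (by decide)
  have m11 := hminor ![1, 3, 5, 7, 0, 2, 4, 6] (by decide) (by decide)
  have m12 := hminor ![2, 3, 4, 5, 0, 1, 6, 7] (by decide) (by decide)
  have m13 := hminor ![2, 3, 6, 7, 0, 1, 4, 5] (by decide) (by decide)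
  have m14 := hminor ![4, 5, 6, 7, 0, 1, 2, 3] (by decide) (by decide)
  simp only [Matrix.cons_val] at m1 m2 m3 m4 m5 m6 m7 m8 m9 m10 m11 m12 m13 m14
  linear_combination h0 - G.det * h4 - (m1 + m2 - m3 + m4 + m5 + m6 - m7 - m8
    + m9 + m10 + m11 - m12 + m13 + m14)

/-- The stabiliser of the Cayley form in `GL(8,ℝ)` is contained in `SO(8)`: any linear
automorphism of `ℝ⁸` preserving `Φ₀` preserves the inner product and has determinant
`1`. -/
theorem stabiliser_phi_subset_SO (g : E8 ≃ₗ[ℝ] E8)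
    (h : ∀ v₁ v₂ v₃ v₄ : E8, Phi (g v₁) (g v₂) (g v₃) (g v₄) = Phi v₁ v₂ v₃ v₄) :
    (∀ x y : E8, (⟪g x, g y⟫ : ℝ) = ⟪x, y⟫) ∧
    LinearMap.det (g : E8 →ₗ[ℝ] E8) = 1 := by
  have hc (v : Fin 4 → E8) : cayleyForm (g ∘ v) = cayleyForm v := by
    have hv (f : Fin 4 → E8) : Phi (f 0) (f 1) (f 2) (f 3) = cayleyForm f := by
      rw [cayleyForm_apply, Phi]
      congr 1
      ext s : 1
      fin_cases s <;> rfl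
    rw [← hv, ← hv]
    exact h _ _ _ _
  have hg := inner_map_map_of_cayleyForm_comp g hc
  exact ⟨hg, det_eq_one_of_cayleyForm_comp g hc hg⟩

end
end

section
/- Let V be a finite-dimensional real inner product space of dimension 2n with n ≥ 1, and let J : V → V be a linear map with J ∘ J = −id and ⟨J x, J y⟩ = ⟨x, y⟩ for all x, y ∈ V. Let L ⊆ V be an n-dimensional subspace with J(L) = Lᗮ (a Lagrangian subspace), let W ⊆ V be a (2n−2)-dimensional subspace with J(W) = W (a complex subspace of complex codimension one), and let H ⊆ L ∩ W be an (n−1)-dimensional subspace. Then every vector u ∈ L orthogonal to H is orthogonal to W. (This is the pointwise linear-algebra core of the statement that a Lagrangian submanifold of a Kähler manifold with boundary in a complex hypersurface meets that hypersurface orthogonally.) -/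
open scoped RealInnerProductSpace

/-- A Lagrangian subspace `L` of a `2n`-dimensional real inner product space with an
orthogonal complex structure `J` meets a complex subspace `W` of complex codimension
one orthogonally along an `(n−1)`-dimensional subspace `H ⊆ L ∩ W`: any `u ∈ L`
orthogonal to `H` is orthogonal to `W`. -/
theorem lagrangian_meets_complex_hypersurface_orthogonally
    {V : Type*} [NormedAddCommGroup V] [InnerProductSpace ℝ V] [FiniteDimensional ℝ V]
    (n : ℕ) (hn : 1 ≤ n) (hdim : Module.finrank ℝ V = 2 * n)
    (J : V →ₗ[ℝ] V) (hJ2 : ∀ x, J (J x) = -x)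
    (hJinner : ∀ x y : V, (⟪J x, J y⟫ : ℝ) = ⟪x, y⟫)
    (L : Submodule ℝ V) (hLdim : Module.finrank ℝ L = n) (hLag : L.map J = Lᗮ)
    (W : Submodule ℝ V) (hWdim : Module.finrank ℝ W = 2 * n - 2) (hWJ : W.map J = W)
    (H : Submodule ℝ V) (hH : H ≤ L ⊓ W) (hHdim : Module.finrank ℝ H = n - 1)
    (u : V) (huL : u ∈ L) (huH : ∀ h ∈ H, (⟪u, h⟫ : ℝ) = 0) :
    ∀ w ∈ W, (⟪u, w⟫ : ℝ) = 0 := by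
  have hJinj : Function.Injective J := fun x y hxy => by
    simpa [hJ2] using congrArg J hxy
  have hJH : ∀ h ∈ H, J h ∈ Lᗮ := fun h hh =>
    hLag ▸ Submodule.mem_map_of_mem (hH hh).1
  have hdisj : H ⊓ H.map J = ⊥ := by
    rw [eq_bot_iff]
    rintro _ ⟨hx, h, hh, rfl⟩
    exact (Submodule.mem_bot ℝ).2 <| inner_self_eq_zero.1 <|
      (Submodule.mem_orthogonal L _).1 (hJH h hh) _ (hH hx).1
  have hle : H ⊔ H.map J ≤ W :=
    sup_le (hH.trans inf_le_right)
      ((Submodule.map_mono (hH.trans inf_le_right)).trans hWJ.le)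
  have hmap : Module.finrank ℝ (H.map J) = n - 1 := by
    rw [← (Submodule.equivMapOfInjective J hJinj H).finrank_eq, hHdim]
  have hsum := Submodule.finrank_sup_add_finrank_inf_eq H (H.map J)
  rw [hdisj, finrank_bot, hHdim, hmap] at hsum
  have hW : H ⊔ H.map J = W :=
    Submodule.eq_of_le_of_finrank_eq hle (by omega)
  intro w hw
  rw [← hW] at hw
  obtain ⟨a, ha, _, ⟨b, hb, rfl⟩, rfl⟩ := Submodule.mem_sup.1 hw
  rw [inner_add_right, huH a ha, (Submodule.mem_orthogonal L _).1 (hJH b hb) u huL, add_zero]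
end

section
/- For all v, w ∈ ℝ⁸ orthogonal to the first standard basis vector u₁, the G₂ cross product satisfies ‖v × w‖² = ‖v‖²·‖w‖² − ⟨v, w⟩². -/
open scoped RealInnerProductSpace

noncomputable section

/-- The `G₂` cross product on the hyperplane `u₁ᗮ`: the unique vector with
`⟪x, v × w⟫ = Φ₀(u₁, x, v, w)` for all `x`. -/
def crossG2 (v w : E8) : E8 :=
  (EuclideanSpace.equiv (Fin 8) ℝ).symm fun i => Phi (stdB 0) (stdB i) v w

/-- Laplace expansion of `dx_{ijkl}` along its first argument. -/
theorem dx4_vecCons (i j k l : Fin 8) (a b c d : E8) :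
    dx4 i j k l ![a, b, c, d] =
      a i * (b j * (c k * d l - c l * d k) - b k * (c j * d l - c l * d j)
        + b l * (c j * d k - c k * d j))
      - a j * (b i * (c k * d l - c l * d k) - b k * (c i * d l - c l * d i)
        + b l * (c i * d k - c k * d i))
      + a k * (b i * (c j * d l - c l * d j) - b j * (c i * d l - c l * d i)
        + b l * (c i * d j - c j * d i))
      - a l * (b i * (c j * d k - c k * d j) - b j * (c i * d k - c k * d i)
        + b k * (c i * d j - c j * d i)) := by
  simp [dx4, Matrix.det_succ_row_zero, Fin.sum_univ_succ, Fin.succAbove]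
  ring

/-- The `G₂` cross product in coordinates. -/
theorem crossG2_eq (v w : E8) :
    crossG2 v w = !₂[0,
      (v 2 * w 3 - v 3 * w 2) + (v 4 * w 5 - v 5 * w 4) - (v 6 * w 7 - v 7 * w 6),
      (v 3 * w 1 - v 1 * w 3) + (v 4 * w 6 - v 6 * w 4) + (v 5 * w 7 - v 7 * w 5),
      (v 1 * w 2 - v 2 * w 1) + (v 4 * w 7 - v 7 * w 4) - (v 5 * w 6 - v 6 * w 5),
      (v 5 * w 1 - v 1 * w 5) + (v 6 * w 2 - v 2 * w 6) + (v 7 * w 3 - v 3 * w 7),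
      (v 1 * w 4 - v 4 * w 1) + (v 7 * w 2 - v 2 * w 7) - (v 6 * w 3 - v 3 * w 6),
      -(v 7 * w 1 - v 1 * w 7) + (v 2 * w 4 - v 4 * w 2) - (v 3 * w 5 - v 5 * w 3),
      -(v 1 * w 6 - v 6 * w 1) + (v 2 * w 5 - v 5 * w 2) + (v 3 * w 4 - v 4 * w 3)] := by
  ext i
  change Phi (stdB 0) (stdB i) v w = _
  fin_cases i <;> simp [Phi, Phi0, dx4_vecCons, stdB]

/-- For `v, w` orthogonal to the first standard basis vector,
`‖v × w‖² = ‖v‖²‖w‖² − ⟪v,w⟫²`. -/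
theorem norm_sq_crossG2 (v w : E8)
    (hv : (⟪v, stdB 0⟫ : ℝ) = 0) (hw : (⟪w, stdB 0⟫ : ℝ) = 0) :
    ‖crossG2 v w‖ ^ 2 = ‖v‖ ^ 2 * ‖w‖ ^ 2 - (⟪v, w⟫ : ℝ) ^ 2 := by
  have hv0 : v 0 = 0 := by simpa [stdB, EuclideanSpace.inner_single_right] using hv
  have hw0 : w 0 = 0 := by simpa [stdB, EuclideanSpace.inner_single_right] using hw
  simp only [crossG2_eq, EuclideanSpace.real_norm_sq_eq, PiLp.inner_apply, Fin.sum_univ_eight,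
    hv0, hw0]
  simp
  ring

end
end
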